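/- Block product states have vanishing conditional mutual information: Let X and Y be random variables with values in finite sets 𝒳 and 𝒴 and let M be a quantum system with Hilbert space ℂ^d = ⊕ᵢ₌₁^N ℂ^{aᵢ} ⊗ ℂ^{bᵢ}. Suppose the joint probability mass function is p(x,y) = Σᵢ r(i) p(x|i) p(y|i) for a probability distribution r on {1,…,N} and conditional distributions p(·|i) on 𝒳 and 𝒴, and the state of M conditioned on X = x, Y = y is the block-diagonal matrix ρ(x,y) = ⊕ᵢ r(i) p(x|i) p(y|i) ρᵢˣ(x) ⊗ ρᵢʸ(y) / p(x,y) (whenever p(x,y) > 0), where ρᵢˣ(x) and ρᵢʸ(y) are states on ℂ^{aᵢ} and ℂ^{bᵢ}. Then I(X:Y|M) = 0. -/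

import Mathlib

open Matrix
open scoped ComplexOrder Kronecker Classical

noncomputable section

/-- A state of a finite-dimensional quantum system: a positive semidefinite matrix with
unit trace. -/
def IsState {ι : Type*} [Fintype ι] [DecidableEq ι] (ρ : Matrix ι ι ℂ) : Prop :=
  ρ.PosSemidef ∧ ρ.trace = 1

/-- The von Neumann entropy `S(ρ) = -Σᵢ λᵢ ln λᵢ`, the sum running over the eigenvalues of
`ρ` (with `0 ln 0 = 0`; junk value `0` on non-Hermitian matrices). -/
def vnEnt {ι : Type*} [Fintype ι] [DecidableEq ι] (ρ : Matrix ι ι ℂ) : ℝ :=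
  if h : ρ.IsHermitian then -∑ i, h.eigenvalues i * Real.log (h.eigenvalues i) else 0

/-- The Shannon entropy `S = -Σ p ln p` of a probability mass function on a finite set. -/
def shannonEnt {𝒳 : Type*} [Fintype 𝒳] (p : 𝒳 → ℝ) : ℝ := -∑ x, p x * Real.log (p x)

/-- The conditional entropy `S(A|M) = S(M|A) + S(A) - S(M)` of the classical system `A` of a
classical-quantum state `(p, ρ)` given the quantum system `M`. -/
def condEntF {𝒳 ι : Type*} [Fintype 𝒳] [Fintype ι] [DecidableEq ι]
    (p : 𝒳 → ℝ) (ρ : 𝒳 → Matrix ι ι ℂ) : ℝ :=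
  (∑ x, p x * vnEnt (ρ x)) + shannonEnt p - vnEnt (∑ x, ((p x : ℝ) : ℂ) • ρ x)

/-- The conditional mutual information `I(X:Y|M) = S(X|M) + S(Y|M) - S(X,Y|M)` of the two
classical systems of a classical-classical-quantum state given the quantum system `M`. -/
def cmiF {𝒳 𝒴 ι : Type*} [Fintype 𝒳] [Fintype 𝒴] [Fintype ι] [DecidableEq ι]
    (p : 𝒳 → 𝒴 → ℝ) (ρ : 𝒳 → 𝒴 → Matrix ι ι ℂ) : ℝ :=
  condEntF (fun x => ∑ y, p x y)
      (fun x => (((∑ y, p x y : ℝ)) : ℂ)⁻¹ • ∑ y, ((p x y : ℝ) : ℂ) • ρ x y)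
    + condEntF (fun y => ∑ x, p x y)
      (fun y => (((∑ x, p x y : ℝ)) : ℂ)⁻¹ • ∑ x, ((p x y : ℝ) : ℂ) • ρ x y)
    - condEntF (fun xy : 𝒳 × 𝒴 => p xy.1 xy.2) (fun xy => ρ xy.1 xy.2)


lemma vnEnt_of_diag {ι : Type*} [Fintype ι] [DecidableEq ι] {A : Matrix ι ι ℂ}
    (hA : A.IsHermitian) (P Q : Matrix ι ι ℂ) (d : ι → ℝ) (hQP : Q * P = 1)
    (h : A = P * Matrix.diagonal (fun i => (d i : ℂ)) * Q) :
    vnEnt A = -∑ i, d i * Real.log (d i) := by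
  have h1 : A.charpoly = ∏ i, (Polynomial.X - Polynomial.C (d i : ℂ)) := by
    rw [h, Matrix.charpoly_mul_comm, ← mul_assoc, hQP, one_mul, Matrix.charpoly_diagonal]
  have h2 := hA.roots_charpoly_eq_eigenvalues
  rw [h1, Polynomial.roots_prod _ _ (by
      simp [Finset.prod_ne_zero_iff, Polynomial.X_sub_C_ne_zero])] at h2
  simp only [Polynomial.roots_X_sub_C, Multiset.bind_singleton] at h2
  have h3 := congrArg (fun m => (Multiset.map (fun z : ℂ => z.re * Real.log z.re) m).sum) h2
  simp only [Multiset.map_map, Function.comp_def] at h3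
  rw [vnEnt, dif_pos hA]
  congr 1
  exact h3.symm

lemma herm_diag {ι : Type*} [Fintype ι] [DecidableEq ι] {A : Matrix ι ι ℂ}
    (hA : A.IsHermitian) : ∃ (P Q : Matrix ι ι ℂ) (d : ι → ℝ), Q * P = 1 ∧
      A = P * Matrix.diagonal (fun i => (d i : ℂ)) * Q := by
  refine ⟨hA.eigenvectorUnitary, star (hA.eigenvectorUnitary : Matrix ι ι ℂ), hA.eigenvalues,
    by simp, ?_⟩
  conv_lhs => rw [hA.spectral_theorem, Unitary.conjStarAlgAut_apply]
  rfl

lemma trace_of_diag {ι : Type*} [Fintype ι] [DecidableEq ι] {A : Matrix ι ι ℂ}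
    (P Q : Matrix ι ι ℂ) (d : ι → ℝ) (hQP : Q * P = 1)
    (h : A = P * Matrix.diagonal (fun i => (d i : ℂ)) * Q) (t : ℝ) (ht : A.trace = (t : ℂ)) :
    ∑ i, d i = t := by
  rw [h, Matrix.trace_mul_comm, ← mul_assoc, hQP, one_mul, Matrix.trace_diagonal] at ht
  exact_mod_cast ht

lemma herm_smul {ι : Type*} {A : Matrix ι ι ℂ} (hA : A.IsHermitian) (c : ℝ) :
    ((c : ℂ) • A).IsHermitian := by
  unfold Matrix.IsHermitian at *
  rw [Matrix.conjTranspose_smul, hA]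
  simp

lemma herm_kron {ι κ : Type*} {A : Matrix ι ι ℂ} {B : Matrix κ κ ℂ} (hA : A.IsHermitian)
    (hB : B.IsHermitian) : (A ⊗ₖ B).IsHermitian := by
  unfold Matrix.IsHermitian at *
  rw [Matrix.conjTranspose_kronecker, hA, hB]

lemma herm_sum {ι κ : Type*} (s : Finset κ) {A : κ → Matrix ι ι ℂ}
    (hA : ∀ k, (A k).IsHermitian) : (∑ k ∈ s, A k).IsHermitian := by
  unfold Matrix.IsHermitian at *
  rw [Matrix.conjTranspose_sum]
  exact Finset.sum_congr rfl fun k _ => hA k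

lemma mul_log_mul (a b : ℝ) :
    a * b * Real.log (a * b) = a * (b * Real.log b) + a * Real.log a * b := by
  rcases eq_or_ne a 0 with rfl | ha
  · simp
  rcases eq_or_ne b 0 with rfl | hb
  · simp
  rw [Real.log_mul ha hb]; ring

lemma vnEnt_smul {ι : Type*} [Fintype ι] [DecidableEq ι] {A : Matrix ι ι ℂ}
    (hA : A.IsHermitian) (c t : ℝ) (ht : A.trace = (t : ℂ)) :
    vnEnt ((c : ℂ) • A) = c * vnEnt A - c * Real.log c * t := by
  obtain ⟨P, Q, d, hQP, h⟩ := herm_diag hA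
  rw [vnEnt_of_diag hA P Q d hQP h, vnEnt_of_diag (herm_smul hA c) P Q (fun i => c * d i) hQP,
    ← trace_of_diag P Q d hQP h t ht]
  · simp only [mul_log_mul, Finset.sum_add_distrib, ← Finset.mul_sum]
    ring
  · have : (Matrix.diagonal (fun i => ((c * d i : ℝ) : ℂ))) =
        (c : ℂ) • Matrix.diagonal (fun i => (d i : ℂ)) := by
      rw [← Matrix.diagonal_smul]; congr 1; ext i; simp
    rw [this, Matrix.mul_smul, Matrix.smul_mul, ← h]

lemma vnEnt_kron {ι κ : Type*} [Fintype ι] [DecidableEq ι] [Fintype κ] [DecidableEq κ]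
    {A : Matrix ι ι ℂ} {B : Matrix κ κ ℂ}
    (hA : A.IsHermitian) (hB : B.IsHermitian) (s t : ℝ) (hs : A.trace = (s : ℂ))
    (ht : B.trace = (t : ℂ)) :
    vnEnt (A ⊗ₖ B) = t * vnEnt A + s * vnEnt B := by
  obtain ⟨P, Q, d, hQP, h⟩ := herm_diag hA
  obtain ⟨P', Q', d', hQP', h'⟩ := herm_diag hB
  rw [vnEnt_of_diag hA P Q d hQP h, vnEnt_of_diag hB P' Q' d' hQP' h',
    vnEnt_of_diag (herm_kron hA hB) (P ⊗ₖ P') (Q ⊗ₖ Q') (fun i => d i.1 * d' i.2),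
    ← trace_of_diag P Q d hQP h s hs, ← trace_of_diag P' Q' d' hQP' h' t ht]
  · rw [Fintype.sum_prod_type]
    simp only [mul_log_mul, Finset.sum_add_distrib, ← Finset.mul_sum, ← Finset.sum_mul]
    ring
  · rw [← Matrix.mul_kronecker_mul, hQP, hQP', Matrix.one_kronecker_one]
  · have : (Matrix.diagonal (fun i : ι × κ => ((d i.1 * d' i.2 : ℝ) : ℂ))) =
        Matrix.diagonal (fun i => (d i : ℂ)) ⊗ₖ Matrix.diagonal (fun i => (d' i : ℂ)) := by
      rw [Matrix.diagonal_kronecker_diagonal]; simp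
    rw [this, ← Matrix.mul_kronecker_mul, ← Matrix.mul_kronecker_mul, ← h, ← h']

lemma herm_block {o : Type*} [DecidableEq o] {m : o → Type*}
    {A : ∀ i, Matrix (m i) (m i) ℂ} (hA : ∀ i, (A i).IsHermitian) :
    (Matrix.blockDiagonal' A).IsHermitian := by
  unfold Matrix.IsHermitian at *
  rw [Matrix.blockDiagonal'_conjTranspose]
  congr 1; ext1 i; exact hA i

lemma vnEnt_block {o : Type*} [Fintype o] [DecidableEq o] {m : o → Type*}
    [∀ i, Fintype (m i)] [∀ i, DecidableEq (m i)] [DecidableEq (Σ i, m i)]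
    {A : ∀ i, Matrix (m i) (m i) ℂ} (hA : ∀ i, (A i).IsHermitian) :
    vnEnt (Matrix.blockDiagonal' A) = ∑ i, vnEnt (A i) := by
  choose P Q d hQP h using fun i => herm_diag (hA i)
  rw [vnEnt_of_diag (herm_block hA) (Matrix.blockDiagonal' P) (Matrix.blockDiagonal' Q)
    (fun i => d i.1 i.2)]
  · rw [Fintype.sum_sigma, ← Finset.sum_neg_distrib]
    exact Finset.sum_congr rfl fun i _ =>
      (vnEnt_of_diag (hA i) (P i) (Q i) (d i) (hQP i) (h i)).symm
  · rw [← Matrix.blockDiagonal'_mul, funext hQP]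
    have h1 := Matrix.blockDiagonal'_one (α := ℂ) (m' := m)
    refine Eq.trans (b := Matrix.blockDiagonal' 1) rfl (h1.trans ?_)
    congr!
  · have : (Matrix.diagonal (fun i : (Σ i, m i) => ((d i.1 i.2 : ℝ) : ℂ))) =
        Matrix.blockDiagonal' fun i => Matrix.diagonal (fun k => (d i k : ℂ)) := by
      rw [Matrix.blockDiagonal'_diagonal]; congr!
    rw [this, ← Matrix.blockDiagonal'_mul, ← Matrix.blockDiagonal'_mul]
    exact congrArg _ (funext h)

lemma condEntF_eq {𝒳 ι : Type*} [Fintype 𝒳] [Fintype ι] [DecidableEq ι]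
    (p : 𝒳 → ℝ) (ρ σ : 𝒳 → Matrix ι ι ℂ) (hσ : ∀ x, (σ x).IsHermitian)
    (ht : ∀ x, (σ x).trace = (p x : ℂ)) (h0 : ∀ x, p x = 0 → σ x = 0)
    (h1 : ∀ x, p x ≠ 0 → ρ x = ((p x : ℂ))⁻¹ • σ x) :
    condEntF p ρ = (∑ x, vnEnt (σ x)) - vnEnt (∑ x, σ x) := by
  have hz : vnEnt (0 : Matrix ι ι ℂ) = 0 := by
    have := vnEnt_smul (ι := ι) Matrix.isHermitian_zero 0 0 (by simp)
    simpa using this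
  have hs : ∀ x, (p x : ℂ) • ρ x = σ x := by
    intro x
    by_cases hp : p x = 0
    · rw [h0 x hp, hp]; simp
    · rw [h1 x hp, smul_inv_smul₀ (by exact_mod_cast hp)]
  unfold condEntF shannonEnt
  simp only [hs]
  congr 1
  rw [← Finset.sum_neg_distrib, ← Finset.sum_add_distrib]
  refine Finset.sum_congr rfl fun x _ => ?_
  by_cases hp : p x = 0
  · rw [h0 x hp, hp, hz]; simp
  · rw [h1 x hp, ← Complex.ofReal_inv, vnEnt_smul (hσ x) _ _ (ht x), Real.log_inv]
    field_simp
    ring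

/-- The unnormalised block product operator. -/
def blk {N : ℕ} {a b : Fin N → ℕ} (r : Fin N → ℝ)
    (A : ∀ i : Fin N, Matrix (Fin (a i)) (Fin (a i)) ℂ)
    (B : ∀ i : Fin N, Matrix (Fin (b i)) (Fin (b i)) ℂ) :
    Matrix (Σ i : Fin N, Fin (a i) × Fin (b i)) (Σ i : Fin N, Fin (a i) × Fin (b i)) ℂ :=
  Matrix.blockDiagonal' fun i => (r i : ℂ) • (A i ⊗ₖ B i)

lemma blk_herm {N : ℕ} {a b : Fin N → ℕ} (r : Fin N → ℝ)
    (A : ∀ i : Fin N, Matrix (Fin (a i)) (Fin (a i)) ℂ)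
    (B : ∀ i : Fin N, Matrix (Fin (b i)) (Fin (b i)) ℂ)
    (hA : ∀ i, (A i).IsHermitian) (hB : ∀ i, (B i).IsHermitian) : (blk r A B).IsHermitian :=
  herm_block fun i => herm_smul (herm_kron (hA i) (hB i)) _

lemma blk_trace {N : ℕ} {a b : Fin N → ℕ} (r : Fin N → ℝ)
    (A : ∀ i : Fin N, Matrix (Fin (a i)) (Fin (a i)) ℂ)
    (B : ∀ i : Fin N, Matrix (Fin (b i)) (Fin (b i)) ℂ) (s t : Fin N → ℝ)
    (hs : ∀ i, (A i).trace = (s i : ℂ)) (ht : ∀ i, (B i).trace = (t i : ℂ)) :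
    (blk r A B).trace = ((∑ i, r i * s i * t i : ℝ) : ℂ) := by
  unfold blk
  rw [Matrix.trace_blockDiagonal']
  push_cast
  refine Finset.sum_congr rfl fun i _ => ?_
  rw [Matrix.trace_smul, Matrix.trace_kronecker, hs, ht, smul_eq_mul, mul_assoc]

lemma blk_ent {N : ℕ} {a b : Fin N → ℕ} (r : Fin N → ℝ)
    (A : ∀ i : Fin N, Matrix (Fin (a i)) (Fin (a i)) ℂ)
    (B : ∀ i : Fin N, Matrix (Fin (b i)) (Fin (b i)) ℂ) (s t : Fin N → ℝ)
    [DecidableEq (Σ i : Fin N, Fin (a i) × Fin (b i))]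
    (hA : ∀ i, (A i).IsHermitian) (hB : ∀ i, (B i).IsHermitian)
    (hs : ∀ i, (A i).trace = (s i : ℂ)) (ht : ∀ i, (B i).trace = (t i : ℂ)) :
    vnEnt (blk r A B) = ∑ i, (r i * (t i * vnEnt (A i) + s i * vnEnt (B i))
      - r i * Real.log (r i) * (s i * t i)) := by
  unfold blk
  rw [vnEnt_block fun i => herm_smul (herm_kron (hA i) (hB i)) _]
  refine Finset.sum_congr rfl fun i _ => ?_
  rw [vnEnt_smul (herm_kron (hA i) (hB i)) (r i) (s i * t i)
    (by rw [Matrix.trace_kronecker, hs, ht]; push_cast; rfl),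
    vnEnt_kron (hA i) (hB i) (s i) (t i) (hs i) (ht i)]

lemma blk_sum_left {N : ℕ} {a b : Fin N → ℕ} (r : Fin N → ℝ) {𝒳 : Type*} [Fintype 𝒳]
    (A : 𝒳 → ∀ i : Fin N, Matrix (Fin (a i)) (Fin (a i)) ℂ)
    (B : ∀ i : Fin N, Matrix (Fin (b i)) (Fin (b i)) ℂ) :
    ∑ x, blk r (A x) B = blk r (fun i => ∑ x, A x i) B := by
  ext ⟨i, k⟩ ⟨j, l⟩
  rw [Matrix.sum_apply]
  by_cases h : i = j
  · subst h
    simp [blk, Matrix.blockDiagonal'_apply_eq, Matrix.sum_apply, Finset.sum_mul, Finset.mul_sum]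
  · simp [blk, Matrix.blockDiagonal'_apply_ne _ _ _ h]

lemma blk_sum_right {N : ℕ} {a b : Fin N → ℕ} (r : Fin N → ℝ) {𝒳 : Type*} [Fintype 𝒳]
    (A : ∀ i : Fin N, Matrix (Fin (a i)) (Fin (a i)) ℂ)
    (B : 𝒳 → ∀ i : Fin N, Matrix (Fin (b i)) (Fin (b i)) ℂ) :
    ∑ x, blk r A (B x) = blk r A (fun i => ∑ x, B x i) := by
  ext ⟨i, k⟩ ⟨j, l⟩
  rw [Matrix.sum_apply]
  by_cases h : i = j
  · subst h
    simp [blk, Matrix.blockDiagonal'_apply_eq, Matrix.sum_apply, Finset.mul_sum]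
  · simp [blk, Matrix.blockDiagonal'_apply_ne _ _ _ h]

/-- Block product states have vanishing conditional mutual information: if the Hilbert
space of `M` is `⊕ᵢ ℂ^{aᵢ} ⊗ ℂ^{bᵢ}`, the joint probability mass function is
`p(x,y) = Σᵢ r(i) p(x|i) p(y|i)` and the state of `M` conditioned on `X = x`, `Y = y` is the
block-diagonal matrix with blocks `r(i) p(x|i) p(y|i) ρᵢˣ(x) ⊗ ρᵢʸ(y) / p(x,y)`, then
`I(X:Y|M) = 0`. -/
theorem block_product_states_vanishing_conditional_mutual_information
    {𝒳 𝒴 : Type*} [Fintype 𝒳] [Fintype 𝒴] {N : ℕ} (a b : Fin N → ℕ)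
    (r : Fin N → ℝ) (px : Fin N → 𝒳 → ℝ) (py : Fin N → 𝒴 → ℝ)
    (hr0 : ∀ i, 0 ≤ r i) (hr1 : ∑ i, r i = 1)
    (hpx0 : ∀ i x, 0 ≤ px i x) (hpx1 : ∀ i, ∑ x, px i x = 1)
    (hpy0 : ∀ i y, 0 ≤ py i y) (hpy1 : ∀ i, ∑ y, py i y = 1)
    (ρX : ∀ i : Fin N, 𝒳 → Matrix (Fin (a i)) (Fin (a i)) ℂ)
    (ρY : ∀ i : Fin N, 𝒴 → Matrix (Fin (b i)) (Fin (b i)) ℂ)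
    (hρX : ∀ i x, IsState (ρX i x)) (hρY : ∀ i y, IsState (ρY i y))
    (p : 𝒳 → 𝒴 → ℝ) (hp : ∀ x y, p x y = ∑ i, r i * px i x * py i y)
    (ρ : 𝒳 → 𝒴 → Matrix (Σ i : Fin N, Fin (a i) × Fin (b i))
                        (Σ i : Fin N, Fin (a i) × Fin (b i)) ℂ)
    (hρ : ∀ x y, 0 < p x y →
      ρ x y = Matrix.blockDiagonal'
        fun i => (((r i * px i x * py i y / p x y : ℝ)) : ℂ) • (ρX i x ⊗ₖ ρY i y)) :
    cmiF p ρ = 0 := by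
  set A : 𝒳 → ∀ i : Fin N, Matrix (Fin (a i)) (Fin (a i)) ℂ :=
    fun x i => (px i x : ℂ) • ρX i x with hAdef
  set B : 𝒴 → ∀ i : Fin N, Matrix (Fin (b i)) (Fin (b i)) ℂ :=
    fun y i => (py i y : ℂ) • ρY i y with hBdef
  have hA : ∀ x i, (A x i).IsHermitian := fun x i => herm_smul (hρX i x).1.1 _
  have hB : ∀ y i, (B y i).IsHermitian := fun y i => herm_smul (hρY i y).1.1 _
  have hAt : ∀ x i, (A x i).trace = (px i x : ℂ) := fun x i => by
    simp [hAdef, Matrix.trace_smul, (hρX i x).2]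
  have hBt : ∀ y i, (B y i).trace = (py i y : ℂ) := fun y i => by
    simp [hBdef, Matrix.trace_smul, (hρY i y).2]
  have hA' : ∀ i, (∑ x, A x i).IsHermitian := fun i => herm_sum _ fun x => hA x i
  have hB' : ∀ i, (∑ y, B y i).IsHermitian := fun i => herm_sum _ fun y => hB y i
  have hAt' : ∀ i, (∑ x, A x i).trace = ((1 : ℝ) : ℂ) := fun i => by
    rw [Matrix.trace_sum, ← hpx1 i]; push_cast; exact Finset.sum_congr rfl fun x _ => hAt x i
  have hBt' : ∀ i, (∑ y, B y i).trace = ((1 : ℝ) : ℂ) := fun i => by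
    rw [Matrix.trace_sum, ← hpy1 i]; push_cast; exact Finset.sum_congr rfl fun y _ => hBt y i
  have hpn : ∀ x y, 0 ≤ p x y := fun x y => by
    rw [hp]
    exact Finset.sum_nonneg fun i _ => mul_nonneg (mul_nonneg (hr0 i) (hpx0 i x)) (hpy0 i y)
  have hblk : ∀ x y, blk r (A x) (B y) = Matrix.blockDiagonal'
      fun i => ((r i * px i x * py i y : ℝ) : ℂ) • (ρX i x ⊗ₖ ρY i y) := by
    intro x y
    unfold blk
    congr 1; ext1 i
    simp only [hAdef, hBdef, Matrix.smul_kronecker, Matrix.kronecker_smul, smul_smul]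
    congr 1
    push_cast
    ring
  have hσt : ∀ x y, (blk r (A x) (B y)).trace = (p x y : ℂ) := fun x y => by
    rw [hp, blk_trace r _ _ _ _ (hAt x) (hBt y)]
  have hσ0 : ∀ x y, p x y = 0 → blk r (A x) (B y) = 0 := by
    intro x y h
    rw [hp, Finset.sum_eq_zero_iff_of_nonneg (fun i _ =>
      mul_nonneg (mul_nonneg (hr0 i) (hpx0 i x)) (hpy0 i y))] at h
    rw [hblk]
    have : (fun i => ((r i * px i x * py i y : ℝ) : ℂ) • (ρX i x ⊗ₖ ρY i y)) = 0 := by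
      ext1 i
      rw [h i (Finset.mem_univ i)]; simp
    rw [this, Matrix.blockDiagonal'_zero]
  have hσ1 : ∀ x y, p x y ≠ 0 → ρ x y = ((p x y : ℂ))⁻¹ • blk r (A x) (B y) := by
    intro x y h
    rw [hρ x y (lt_of_le_of_ne (hpn x y) (Ne.symm h)), hblk, ← Matrix.blockDiagonal'_smul]
    congr 1; ext1 i
    rw [Pi.smul_apply, smul_smul]
    congr 1
    push_cast
    ring
  have hσ : ∀ x y, (p x y : ℂ) • ρ x y = blk r (A x) (B y) := by
    intro x y
    by_cases h : p x y = 0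
    · rw [hσ0 x y h, h]; simp
    · rw [hσ1 x y h, smul_inv_smul₀ (by exact_mod_cast h)]
  unfold cmiF
  simp only [hσ]
  rw [condEntF_eq (fun x => ∑ y, p x y) _ (fun x => ∑ y, blk r (A x) (B y)),
    condEntF_eq (fun y => ∑ x, p x y) _ (fun y => ∑ x, blk r (A x) (B y)),
    condEntF_eq (fun xy : 𝒳 × 𝒴 => p xy.1 xy.2) _ (fun xy => blk r (A xy.1) (B xy.2))]
  · simp only [Fintype.sum_prod_type]
    rw [Finset.sum_comm (f := fun y x => blk r (A x) (B y))]
    simp only [blk_sum_right]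
    rw [Finset.sum_congr rfl fun y _ => congrArg vnEnt (blk_sum_left r A (B y))]
    rw [blk_sum_left r A (fun i => ∑ y, B y i)]
    rw [blk_ent r _ _ _ _ hA' hB' hAt' hBt']
    rw [Finset.sum_congr rfl fun x _ => blk_ent r _ _ _ _ (hA x) hB' (hAt x) hBt',
      Finset.sum_congr rfl fun y _ => blk_ent r _ _ _ _ hA' (hB y) hAt' (hBt y),
      Finset.sum_congr rfl fun x _ => Finset.sum_congr rfl fun y _ =>
        blk_ent r _ _ _ _ (hA x) (hB y) (hAt x) (hBt y)]
    rw [Finset.sum_congr rfl fun x _ => Finset.sum_comm]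
    rw [Finset.sum_comm, Finset.sum_comm (s := (Finset.univ : Finset 𝒴)),
      Finset.sum_comm (s := (Finset.univ : Finset 𝒳)) (t := (Finset.univ : Finset (Fin N)))]
    simp only [← Finset.sum_sub_distrib, ← Finset.sum_add_distrib]
    refine Finset.sum_eq_zero fun i _ => ?_
    simp only [Finset.sum_sub_distrib, Finset.sum_add_distrib, ← Finset.mul_sum,
      ← Finset.sum_mul, hpx1, hpy1]
    ring
  · exact fun xy => blk_herm r _ _ (hA _) (hB _)
  · exact fun xy => hσt _ _
  · exact fun xy => hσ0 _ _
  · exact fun xy => hσ1 _ _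
  · exact fun y => herm_sum _ fun x => blk_herm r _ _ (hA _) (hB _)
  · intro y
    rw [Matrix.trace_sum]; push_cast; exact Finset.sum_congr rfl fun x _ => hσt x y
  · intro y h
    rw [Finset.sum_eq_zero_iff_of_nonneg (fun x _ => hpn x y)] at h
    exact Finset.sum_eq_zero fun x hx => hσ0 x y (h x hx)
  · exact fun y _ => rfl
  · exact fun x => herm_sum _ fun y => blk_herm r _ _ (hA _) (hB _)
  · intro x
    rw [Matrix.trace_sum]; push_cast; exact Finset.sum_congr rfl fun y _ => hσt x y
  · intro x h
    rw [Finset.sum_eq_zero_iff_of_nonneg (fun y _ => hpn x y)] at h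
    exact Finset.sum_eq_zero fun y hy => hσ0 x y (h y hy)
  · exact fun x _ => rfl

end
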